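/- arXiv:1601.04666 — 4 statements merged into one kernel-verified Lean document; each statement's English description precedes it below -/
import Mathlib

section
/- Let K and P be symmetric 2×2 complex matrices (Kᵀ = K and Pᵀ = P), and let J be the 2×2 complex matrix with entries J 0 0 = J 1 1 = 0, J 0 1 = 1, J 1 0 = −1. If det K ≠ 0 and K * J * P = P * J * K (matrix products), then there exists a constant c ∈ ℂ such that P = c • K. -/
/-- The spinor Levi-Civita symbol ε as a 2×2 complex matrix. -/
noncomputable def J : Matrix (Fin 2) (Fin 2) ℂ := !![0, 1; -1, 0]

/-- If K is an invertible symmetric 2×2 complex matrix, P is symmetric, and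
    K J P = P J K (the matter alignment condition), then P is proportional to K. -/
theorem alignment_forces_proportionality
    (K P : Matrix (Fin 2) (Fin 2) ℂ)
    (hK : K.transpose = K) (hP : P.transpose = P)
    (hdet : K.det ≠ 0)
    (h : K * J * P = P * J * K) :
    ∃ c : ℂ, P = c • K := by
  have k := congrFun (congrFun hK 0) 1
  have p := congrFun (congrFun hP 0) 1
  have h00 := congrFun (congrFun h 0) 0
  have h01 := congrFun (congrFun h 0) 1
  have h11 := congrFun (congrFun h 1) 1
  simp only [Matrix.transpose_apply] at k p
  simp [J, Matrix.mul_apply, Fin.sum_univ_two, k, p] at h00 h01 h11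
  rw [Matrix.det_fin_two, k] at hdet
  have e1 : K 0 0 * P 0 1 = K 0 1 * P 0 0 := by linear_combination h00 / 2
  have e2 : K 0 0 * P 1 1 = P 0 0 * K 1 1 := by linear_combination h01
  have e3 : K 0 1 * P 1 1 = K 1 1 * P 0 1 := by linear_combination h11 / 2
  by_cases ha : K 0 0 = 0
  · have hb : K 0 1 ≠ 0 := by
      intro hb
      apply hdet
      rw [ha, hb]
      ring
    refine ⟨P 0 1 / K 0 1, ?_⟩
    ext i j
    fin_cases i <;> fin_cases j <;> simp [k, p] <;> field_simp <;>
      first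
        | linear_combination e1
        | linear_combination -e1
        | linear_combination e3
  · refine ⟨P 0 0 / K 0 0, ?_⟩
    ext i j
    fin_cases i <;> fin_cases j <;> simp [k, p] <;> field_simp <;>
      first
        | linear_combination e1
        | linear_combination e2
end

section
/- Let K be a symmetric 2×2 complex matrix with det K ≠ 0. Then there exist a nonzero scalar ϰ ∈ ℂ and vectors o, ι : Fin 2 → ℂ with o 0 * ι 1 − o 1 * ι 0 = 1 such that K A B = ϰ * (o A * ι B + ι A * o B)/2 for all A, B ∈ Fin 2. -/
/-- An algebraically general symmetric spinor admits the basis expansion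
    κ_{AB} = ϰ o_{(A} ι_{B)} with respect to a normalised spin dyad {o, ι}. -/
theorem dyad_expansion
    (K : Matrix (Fin 2) (Fin 2) ℂ) (hsym : K.transpose = K) (hdet : K.det ≠ 0) :
    ∃ (ϰ : ℂ) (o ι : Fin 2 → ℂ), ϰ ≠ 0 ∧ o 0 * ι 1 - o 1 * ι 0 = 1 ∧
      ∀ A B, K A B = ϰ * (o A * ι B + ι A * o B) / 2 := by
  have h10 : K 1 0 = K 0 1 := congrFun (congrFun hsym 0) 1
  rw [Matrix.det_fin_two, h10] at hdet
  suffices H : ∃ (k o0 o1 i0 i1 : ℂ), k ≠ 0 ∧ o0 * i1 - o1 * i0 = 1 ∧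
      K 0 0 = k * (o0 * i0 + i0 * o0) / 2 ∧ K 0 1 = k * (o0 * i1 + i0 * o1) / 2 ∧
      K 1 1 = k * (o1 * i1 + i1 * o1) / 2 by
    obtain ⟨k, o0, o1, i0, i1, hk, hp, h0, h1, h2⟩ := H
    refine ⟨k, ![o0, o1], ![i0, i1], hk, by simpa using hp, ?_⟩
    rw [Fin.forall_fin_two, Fin.forall_fin_two, Fin.forall_fin_two, h10]
    simp only [Matrix.cons_val_zero, Matrix.cons_val_one]
    refine ⟨⟨h0, h1⟩, ?_, h2⟩
    rw [h1]; ring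
  generalize K 0 0 = a at *
  generalize K 0 1 = b at *
  generalize K 1 1 = c at *
  by_cases ha : a = 0
  · subst ha
    have hb : b ≠ 0 := by
      rintro rfl
      simp at hdet
    refine ⟨2 * b, 1, c / (2 * b), 0, 1, by simpa using hb, by ring, by ring, by ring, ?_⟩
    field_simp
    ring
  · obtain ⟨s, hs⟩ := IsAlgClosed.exists_pow_nat_eq (b ^ 2 - a * c) (n := 2) (by norm_num)
    have hs0 : s ≠ 0 := by
      rintro rfl
      apply hdet
      linear_combination hs
    refine ⟨-2 * s, a, b + s, -1 / (2 * s), -(b - s) / (2 * a * s), by simpa using hs0, ?_, ?_, ?_, ?_⟩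
    · field_simp
      ring
    · field_simp
      ring
    · field_simp
      ring
    · field_simp
      linear_combination 2 * hs
end

section
/- Let q, Q ∈ MvPolynomial (Fin 2) ℂ be homogeneous polynomials of degrees 2 and 4 respectively, with q ≠ 0. If the Jacobian vanishes identically, i.e. (pderiv 0 q) * (pderiv 1 Q) − (pderiv 1 q) * (pderiv 0 Q) = 0, then there exists c ∈ ℂ such that Q = c • q^2. -/
open MvPolynomial in
lemma binary_form_expand (n : ℕ) (p : MvPolynomial (Fin 2) ℂ) (hp : p.IsHomogeneous n) :
    ∃ f : ℕ → ℂ, p = ∑ i ∈ Finset.range (n + 1), C (f i) * (X 0 ^ i * X 1 ^ (n - i)) := by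
  let g : ℕ → (Fin 2 →₀ ℕ) := fun i => Finsupp.single 0 i + Finsupp.single 1 (n - i)
  have g0 : ∀ i, g i 0 = i := fun i => by simp [g]
  have hinj : Function.Injective g := fun i j h => by rw [← g0 i, ← g0 j, h]
  refine ⟨fun i => coeff (g i) p, ?_⟩
  have hsub : p.support ⊆ (Finset.range (n + 1)).image g := by
    intro d hd
    have h1 : d.degree = n := by
      have := hp (mem_support_iff.mp hd)
      rwa [Finsupp.degree_eq_weight_one]
    have h2 : d 0 + d 1 = n := by
      rw [← h1, Finsupp.degree_eq_sum, Fin.sum_univ_two]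
    refine Finset.mem_image.mpr ⟨d 0, Finset.mem_range.mpr (by omega), ?_⟩
    ext k
    fin_cases k
    · simp [g]
    · simp [g]; omega
  conv_lhs => rw [p.as_sum]
  rw [Finset.sum_subset hsub (fun d _ hd => by
    rw [notMem_support_iff.mp hd, monomial_zero]), Finset.sum_image hinj.injOn]
  refine Finset.sum_congr rfl fun i _ => ?_
  rw [X_pow_eq_monomial, X_pow_eq_monomial, monomial_mul, C_mul_monomial]
  simp [g]

open MvPolynomial in
/-- If q and Q are binary forms of degrees 2 and 4 with q ≠ 0 and vanishing
    Jacobian, then Q is proportional to q². -/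
theorem quartic_proportional_to_square_of_quadratic
    (q Q : MvPolynomial (Fin 2) ℂ)
    (hq : q.IsHomogeneous 2) (hQ : Q.IsHomogeneous 4) (hq0 : q ≠ 0)
    (hJac : (pderiv 0 q) * (pderiv 1 Q) - (pderiv 1 q) * (pderiv 0 Q) = 0) :
    ∃ c : ℂ, Q = c • q ^ 2 := by
  obtain ⟨f, hf⟩ := binary_form_expand 2 q hq
  obtain ⟨e, he⟩ := binary_form_expand 4 Q hQ
  simp only [Finset.sum_range_succ, Finset.sum_range_zero, zero_add] at hf he
  norm_num at hf he
  generalize f 0 = c at *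
  generalize f 1 = b at *
  generalize f 2 = a at *
  generalize e 0 = e4 at *
  generalize e 1 = e3 at *
  generalize e 2 = e2 at *
  generalize e 3 = e1 at *
  generalize e 4 = e0 at *
  have key : ∀ s t : ℂ, (2*a*s+b*t)*(e1*s^3+2*e2*s^2*t+3*e3*s*t^2+4*e4*t^3)
      - (b*s+2*c*t)*(4*e0*s^3+3*e1*s^2*t+2*e2*s*t^2+e3*t^3) = 0 := by
    intro s t
    have h := congrArg (eval ![s, t]) hJac
    rw [hf, he] at h
    simp [pderiv_X, Derivation.leibniz, Derivation.leibniz_pow, Pi.single_apply] at h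
    linear_combination h
  have k1 := key 1 0
  have k2 := key 0 1
  have k3 := key 1 1
  have k4 := key 1 (-1)
  have k5 := key 1 2
  have E0 : a*e1 = 2*b*e0 := by linear_combination k1/2
  have E4 : 2*b*e4 = c*e3 := by linear_combination k2/2
  have E2 : a*e3 = c*e1 := by linear_combination (k3+k4-2*k1-2*k2)/12
  have E3 : 4*a*e4 + b*e3 = 2*c*e2 := by
    linear_combination (k5-k1-16*k2-4*((k3+k4-2*k1-2*k2)/2)-2*((k3-k4)/2))/12
  have E1 : 2*a*e2 = b*e1 + 4*c*e0 := by
    linear_combination (k3-k4)/4 - (k5-k1-16*k2-4*((k3+k4-2*k1-2*k2)/2)-2*((k3-k4)/2))/12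
  suffices H : ∃ k, e0 = k*a^2 ∧ e1 = k*(2*a*b) ∧ e2 = k*(b^2+2*a*c) ∧ e3 = k*(2*b*c)
      ∧ e4 = k*c^2 by
    obtain ⟨k, rfl, rfl, rfl, rfl, rfl⟩ := H
    refine ⟨k, ?_⟩
    rw [hf, he, smul_eq_C_mul]
    simp only [map_mul, map_add, map_pow, map_ofNat]
    ring
  by_cases ha : a = 0
  · by_cases hc : c = 0
    · have hb : b ≠ 0 := by
        rintro rfl
        apply hq0
        rw [hf, ha, hc]; simp
      subst ha hc
      refine ⟨e2/b^2, ?_⟩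
      have h0 : e0 = 0 := by simpa [hb] using E0
      have h4 : e4 = 0 := by simpa [hb] using E4
      have h1 : e1 = 0 := by simpa [hb] using E1
      have h3 : e3 = 0 := by simpa [hb] using E3
      subst h0 h1 h3 h4
      simp [hb]
    · have h3 : e3 = 2*b*e4/c := by field_simp; linear_combination -E4
      have h2 : e2 = (4*a*e4+b*e3)/(2*c) := by field_simp; linear_combination -E3
      have h1 : e1 = a*e3/c := by field_simp; linear_combination -E2
      have h0 : e0 = (2*a*e2-b*e1)/(4*c) := by field_simp; linear_combination -E1
      refine ⟨e4/c^2, ?_, ?_, ?_, ?_, ?_⟩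
      · rw [h0, h1, h2, h3]; field_simp; ring
      · rw [h1, h3]; field_simp
      · rw [h2, h3]; field_simp; ring
      · rw [h3]; field_simp
      · field_simp
  · have h1 : e1 = 2*b*e0/a := by field_simp; linear_combination E0
    have h2 : e2 = (4*c*e0+b*e1)/(2*a) := by field_simp; linear_combination E1
    have h3 : e3 = c*e1/a := by field_simp; linear_combination E2
    have h4 : e4 = (2*c*e2-b*e3)/(4*a) := by field_simp; linear_combination E3
    refine ⟨e0/a^2, ?_, ?_, ?_, ?_, ?_⟩
    · field_simp
    · rw [h1]; field_simp
    · rw [h2, h1]; field_simp; ring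
    · rw [h3, h1]; field_simp
    · rw [h4, h3, h2, h1]; field_simp; ring
end

section
/- Let o, ι : Fin 2 → ℂ satisfy o 0 * ι 1 − o 1 * ι 0 = 1, and let ϰ, ψ ∈ ℂ. Let ε : Fin 2 → Fin 2 → ℂ be given by ε 0 0 = ε 1 1 = 0, ε 0 1 = 1, ε 1 0 = −1. Define κ A B = ϰ * (o A * ι B + ι A * o B)/2, define Ψ A B C D = ψ * (average over all 24 permutations (A',B',C',D') of (A,B,C,D) of o A' * o B' * ι C' * ι D'), and raise indices by κ^{CD} = Σ_{E,F} ε C E * ε D F * κ E F. Then for all A, B ∈ Fin 2: −(3/4) * Σ_{C,D} Ψ A B C D * κ^{CD} = (ϰ * ψ / 4) * (o A * ι B + ι A * o B)/2. -/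
/-- The spinor Levi-Civita symbol ε_{AB}. -/
noncomputable def eps : Fin 2 → Fin 2 → ℂ := fun A B => !![0, 1; -1, 0] A B

/-- A sum over the permutations of `Fin 4`, written out through `decomposeFin`. -/
theorem sum_perm_four (g : Fin 4 → Fin 4 → Fin 4 → Fin 4 → ℂ) :
    ∑ σ : Equiv.Perm (Fin 4), g (σ 0) (σ 1) (σ 2) (σ 3) =
      ∑ p : Fin 4, ∑ q : Fin 3, ∑ r : Fin 2,
        (fun σ : Equiv.Perm (Fin 4) => g (σ 0) (σ 1) (σ 2) (σ 3))
          (Equiv.Perm.decomposeFin.symm (p, Equiv.Perm.decomposeFin.symm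
            (q, Equiv.Perm.decomposeFin.symm (r, 1)))) := by
  rw [← Equiv.sum_comp (Equiv.Perm.decomposeFin (n := 3)).symm, Fintype.sum_prod_type]
  refine Finset.sum_congr rfl fun p _ => ?_
  rw [← Equiv.sum_comp (Equiv.Perm.decomposeFin (n := 2)).symm, Fintype.sum_prod_type]
  refine Finset.sum_congr rfl fun q _ => ?_
  rw [← Equiv.sum_comp (Equiv.Perm.decomposeFin (n := 1)).symm, Fintype.sum_prod_type]
  refine Finset.sum_congr rfl fun r _ => ?_
  rw [Fintype.sum_unique]
  rfl

/-- The symmetrised product, expanded into its six distinct terms. -/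
theorem sum_perm_dyad (u v : Fin 4 → ℂ) :
    ∑ σ : Equiv.Perm (Fin 4), u (σ 0) * u (σ 1) * v (σ 2) * v (σ 3) =
      4 * (u 0 * u 1 * v 2 * v 3 + u 0 * u 2 * v 1 * v 3 + u 0 * u 3 * v 1 * v 2 +
        u 1 * u 2 * v 0 * v 3 + u 1 * u 3 * v 0 * v 2 + u 2 * u 3 * v 0 * v 1) := by
  rw [sum_perm_four (fun a b c d => u a * u b * v c * v d)]
  have key0 : ∀ (p : Fin 4) (q : Fin 3) (r : Fin 2),
      (Equiv.Perm.decomposeFin.symm (p, Equiv.Perm.decomposeFin.symm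
        (q, Equiv.Perm.decomposeFin.symm (r, 1)))) 0 =
      p := by decide
  have key1 : ∀ (p : Fin 4) (q : Fin 3) (r : Fin 2),
      (Equiv.Perm.decomposeFin.symm (p, Equiv.Perm.decomposeFin.symm
        (q, Equiv.Perm.decomposeFin.symm (r, 1)))) 1 =
      Equiv.swap 0 p q.succ := by decide
  have key2 : ∀ (p : Fin 4) (q : Fin 3) (r : Fin 2),
      (Equiv.Perm.decomposeFin.symm (p, Equiv.Perm.decomposeFin.symm
        (q, Equiv.Perm.decomposeFin.symm (r, 1)))) 2 =
      Equiv.swap 0 p (Equiv.swap 0 q r.succ).succ := by decide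
  have key3 : ∀ (p : Fin 4) (q : Fin 3) (r : Fin 2),
      (Equiv.Perm.decomposeFin.symm (p, Equiv.Perm.decomposeFin.symm
        (q, Equiv.Perm.decomposeFin.symm (r, 1)))) 3 =
      Equiv.swap 0 p (Equiv.swap 0 q (Equiv.swap 0 r 1).succ).succ := by decide
  simp only [key0, key1, key2, key3, Fin.sum_univ_four, Fin.sum_univ_three, Fin.sum_univ_two]
  simp +decide [Equiv.swap_apply_def]
  ring

/-- With κ_{AB} = ϰ o_{(A} ι_{B)} and Ψ_{ABCD} = ψ o_{(A} o_B ι_C ι_{D)} for a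
    normalised dyad {o, ι}, the Killing form spinor η_{AB} = −(3/4) Ψ_{ABCD} κ^{CD}
    equals (ϰψ/4) o_{(A} ι_{B)}. -/
theorem killing_form_spinor_expansion
    (o ι : Fin 2 → ℂ) (hnorm : o 0 * ι 1 - o 1 * ι 0 = 1) (ϰ ψ : ℂ)
    (κ : Fin 2 → Fin 2 → ℂ)
    (hκ : ∀ A B, κ A B = ϰ * (o A * ι B + ι A * o B) / 2)
    (Ψ : Fin 2 → Fin 2 → Fin 2 → Fin 2 → ℂ)
    (hΨ : ∀ A B C D, Ψ A B C D = ψ *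
      ((∑ σ : Equiv.Perm (Fin 4),
        o (![A, B, C, D] (σ 0)) * o (![A, B, C, D] (σ 1)) *
        ι (![A, B, C, D] (σ 2)) * ι (![A, B, C, D] (σ 3))) / 24))
    (κUp : Fin 2 → Fin 2 → ℂ)
    (hκUp : ∀ C D, κUp C D = ∑ E, ∑ F, eps C E * eps D F * κ E F) :
    ∀ A B, -(3 / 4) * (∑ C, ∑ D, Ψ A B C D * κUp C D)
      = (ϰ * ψ / 4) * (o A * ι B + ι A * o B) / 2 := by
  have hP : ∀ A B C D, Ψ A B C D = ψ * ((4 * (o A * o B * ι C * ι D + o A * o C * ι B * ι D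
      + o A * o D * ι B * ι C + o B * o C * ι A * ι D + o B * o D * ι A * ι C
      + o C * o D * ι A * ι B)) / 24) := by
    intro A B C D
    rw [hΨ, sum_perm_dyad (fun i => o (![A, B, C, D] i)) (fun i => ι (![A, B, C, D] i))]
    rfl
  intro A B
  simp only [hP, hκUp, hκ, Fin.sum_univ_two, eps]
  simp only [Matrix.of_apply, Matrix.cons_val', Matrix.cons_val_zero, Matrix.cons_val_one,
    Matrix.cons_val_fin_one]
  linear_combination ((ϰ * ψ / 4) * (o A * ι B + ι A * o B) / 2) *
    (o 0 * ι 1 - o 1 * ι 0 + 1) * hnorm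
end
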